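/- Let √2 − 1 < α < 1 and let X be an ℕ-valued random variable satisfying the recursive distributional equation. Then P(X = 0) > 1 − α and E[X] = ∞ (i.e. ∑_{k≥0} k·P(X = k) = ∞). -/

import Mathlib

open scoped ENNReal

/-- The Poisson(α) probability mass function on ℕ. -/
noncomputable def poissonPMF (α : ℝ) (k : ℕ) : ℝ≥0∞ :=
  ENNReal.ofReal (Real.exp (-α) * α ^ k / (Nat.factorial k))

/-- The Geometric(1/2) pmf: P(N = k) = (1/2)^(k+1) for k ≥ 0. -/
noncomputable def geomHalf (k : ℕ) : ℝ≥0∞ := (1 / 2) ^ (k + 1)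

/-- The law of (X - 1)⁺ when X has law μ on ℕ. -/
noncomputable def shiftLaw (μ : ℕ → ℝ≥0∞) (k : ℕ) : ℝ≥0∞ :=
  if k = 0 then μ 0 + μ 1 else μ (k + 1)

/-- Convolution of two (sub-)pmfs on ℕ: the law of an independent sum. -/
noncomputable def convAdd (f g : ℕ → ℝ≥0∞) (k : ℕ) : ℝ≥0∞ :=
  ∑ j ∈ Finset.range (k + 1), f j * g (k - j)

/-- n-fold convolution of a pmf on ℕ: the law of a sum of n i.i.d. copies. -/
noncomputable def iterConv (f : ℕ → ℝ≥0∞) : ℕ → ℕ → ℝ≥0∞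
  | 0 => fun k => if k = 0 then 1 else 0
  | n + 1 => convAdd (iterConv f n) f

/-- μ is the law of an ℕ-valued random variable X satisfying the RDE
    X =_d P + ∑_{i=1}^N (X_i - 1)⁺, with P ~ Poisson(α), N ~ Geom(1/2),
    X_i i.i.d. with law μ, all independent. -/
def SatisfiesRDE (α : ℝ) (μ : ℕ → ℝ≥0∞) : Prop :=
  (∑' k, μ k) = 1 ∧
  ∀ k, μ k = ∑' n, geomHalf n * convAdd (poissonPMF α) (iterConv (shiftLaw μ) n) k

/-- The probability generating function G(s) = E[s^X]. -/
noncomputable def pgf (μ : ℕ → ℝ≥0∞) (s : ℝ) : ℝ := ∑' k, (μ k).toReal * s ^ k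

/-- The mean E[X] = ∑ k · P(X = k), valued in [0,∞]. -/
noncomputable def meanENN (μ : ℕ → ℝ≥0∞) : ℝ≥0∞ := ∑' k : ℕ, (k : ℝ≥0∞) * μ k

/-- The `ℝ≥0∞`-valued generating function of a sequence of weights. -/
noncomputable def genFun (f : ℕ → ℝ≥0∞) (s : ℝ≥0∞) : ℝ≥0∞ := ∑' k, f k * s ^ k

theorem ENNReal.tsum_nat_eq_zero_add (f : ℕ → ℝ≥0∞) : ∑' k, f k = f 0 + ∑' k, f (k + 1) :=
  tsum_eq_zero_add' ENNReal.summable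

theorem genFun_convAdd (f g : ℕ → ℝ≥0∞) (s : ℝ≥0∞) :
    genFun (convAdd f g) s = genFun f s * genFun g s := by
  have hprod : genFun f s * genFun g s
      = ∑' x : ℕ × ℕ, (f x.1 * s ^ x.1) * (g x.2 * s ^ x.2) := by
    rw [ENNReal.tsum_prod (f := fun a b => (f a * s ^ a) * (g b * s ^ b))]
    simp only [genFun, ENNReal.tsum_mul_left, ENNReal.tsum_mul_right]
  rw [hprod, ← Finset.HasAntidiagonal.sigmaAntidiagonalEquivProd.tsum_eq, ENNReal.tsum_sigma']
  refine tsum_congr fun n => ?_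
  rw [tsum_fintype, convAdd, Finset.sum_mul,
    ← Finset.Nat.sum_antidiagonal_eq_sum_range_succ_mk (fun x : ℕ × ℕ => f x.1 * g x.2 * s ^ n),
    ← Finset.sum_coe_sort]
  refine Finset.sum_congr rfl fun x _ => ?_
  have hx : x.1.1 + x.1.2 = n := Finset.HasAntidiagonal.mem_antidiagonal.mp x.2
  simp only [Finset.HasAntidiagonal.sigmaAntidiagonalEquivProd_apply]
  have hs : s ^ n = s ^ x.1.1 * s ^ x.1.2 := by rw [← pow_add, hx]
  rw [hs]
  ring

theorem genFun_iterConv (f : ℕ → ℝ≥0∞) (s : ℝ≥0∞) (n : ℕ) :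
    genFun (iterConv f n) s = genFun f s ^ n := by
  induction n with
  | zero =>
    rw [genFun, tsum_eq_single 0]
    · simp [iterConv]
    · intro k hk
      simp [iterConv, hk]
  | succ n ih => rw [iterConv, genFun_convAdd, ih, pow_succ]

theorem genFun_poissonPMF {α s : ℝ} (hα : 0 ≤ α) (hs : 0 ≤ s) :
    genFun (poissonPMF α) (ENNReal.ofReal s) = ENNReal.ofReal (Real.exp (α * (s - 1))) := by
  have hsum : HasSum (fun k : ℕ => Real.exp (-α) * ((α * s) ^ k / (Nat.factorial k : ℝ)))
      (Real.exp (-α) * Real.exp (α * s)) := by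
    rw [Real.exp_eq_exp_ℝ]
    exact (NormedSpace.expSeries_div_hasSum_exp (α * s)).mul_left _
  have hexp : Real.exp (α * (s - 1)) = Real.exp (-α) * Real.exp (α * s) := by
    rw [← Real.exp_add]
    ring_nf
  rw [hexp, ← hsum.tsum_eq, ENNReal.ofReal_tsum_of_nonneg (fun k => by positivity) hsum.summable]
  refine tsum_congr fun k => ?_
  rw [poissonPMF, ← ENNReal.ofReal_pow hs, ← ENNReal.ofReal_mul (by positivity)]
  congr 1
  rw [mul_pow]
  ring

theorem mul_genFun_shiftLaw (μ : ℕ → ℝ≥0∞) (s : ℝ≥0∞) :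
    s * genFun (shiftLaw μ) s + μ 0 = s * μ 0 + genFun μ s := by
  have h1 : genFun (shiftLaw μ) s = μ 0 + ∑' k, μ (k + 1) * s ^ k := by
    rw [genFun, ENNReal.tsum_nat_eq_zero_add,
      ENNReal.tsum_nat_eq_zero_add fun k => μ (k + 1) * s ^ k]
    simp [shiftLaw, add_assoc]
  have h2 : genFun μ s = μ 0 + s * ∑' k, μ (k + 1) * s ^ k := by
    rw [genFun, ENNReal.tsum_nat_eq_zero_add, ← ENNReal.tsum_mul_left]
    simp only [pow_zero, mul_one]
    congr 1
    exact tsum_congr fun k => by ring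
  rw [h1, h2]
  ring

theorem genFun_le_tsum (f : ℕ → ℝ≥0∞) {s : ℝ≥0∞} (hs : s ≤ 1) : genFun f s ≤ ∑' k, f k :=
  ENNReal.tsum_le_tsum fun k => mul_le_of_le_one_right' (pow_le_one' hs k)

theorem tsum_shiftLaw (μ : ℕ → ℝ≥0∞) : ∑' k, shiftLaw μ k = ∑' k, μ k := by
  rw [ENNReal.tsum_nat_eq_zero_add, ENNReal.tsum_nat_eq_zero_add μ,
    ENNReal.tsum_nat_eq_zero_add fun k => μ (k + 1)]
  simp [shiftLaw, add_assoc]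

theorem SatisfiesRDE.genFun_eq {α : ℝ} {μ : ℕ → ℝ≥0∞} (hμ : SatisfiesRDE α μ) (s : ℝ≥0∞) :
    genFun μ s = genFun (poissonPMF α) s * (2⁻¹ * (1 - 2⁻¹ * genFun (shiftLaw μ) s)⁻¹) := by
  have h : genFun μ s
      = ∑' n, geomHalf n * genFun (convAdd (poissonPMF α) (iterConv (shiftLaw μ) n)) s := by
    simp only [genFun]
    calc ∑' k, μ k * s ^ k
        = ∑' k, ∑' n, geomHalf n * convAdd (poissonPMF α) (iterConv (shiftLaw μ) n) k * s ^ k :=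
          tsum_congr fun k => by rw [ENNReal.tsum_mul_right, ← hμ.2 k]
      _ = _ := by
          rw [ENNReal.tsum_comm]
          refine tsum_congr fun n => ?_
          rw [← ENNReal.tsum_mul_left]
          exact tsum_congr fun k => by ring
  rw [h, ← ENNReal.tsum_geometric, ← ENNReal.tsum_mul_left, ← ENNReal.tsum_mul_left]
  refine tsum_congr fun n => ?_
  rw [genFun_convAdd, genFun_iterConv, geomHalf, one_div, mul_pow, pow_succ]
  ring

/-- The generating function of a solution of the recursive distributional equation is a root
of an explicit quadratic polynomial. -/
theorem SatisfiesRDE.quadratic {α : ℝ} {μ : ℕ → ℝ≥0∞} (hμ : SatisfiesRDE α μ) (hα : 0 ≤ α)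
    {s : ℝ} (hs0 : 0 ≤ s) (hs1 : s ≤ 1) :
    (genFun μ (ENNReal.ofReal s)).toReal *
        ((μ 0).toReal + (2 - (μ 0).toReal) * s - (genFun μ (ENNReal.ofReal s)).toReal)
      = s * Real.exp (α * (s - 1)) := by
  have hs : ENNReal.ofReal s ≤ 1 := ENNReal.ofReal_le_one.mpr hs1
  have hG := hμ.genFun_eq (ENNReal.ofReal s)
  have hH := mul_genFun_shiftLaw μ (ENNReal.ofReal s)
  have hG1 : genFun μ (ENNReal.ofReal s) ≤ 1 := hμ.1 ▸ genFun_le_tsum μ hs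
  have hH1 : genFun (shiftLaw μ) (ENNReal.ofReal s) ≤ 1 := by
    rw [← hμ.1, ← tsum_shiftLaw]
    exact genFun_le_tsum _ hs
  have hp : μ 0 ≠ ∞ := ne_top_of_le_ne_top ENNReal.one_ne_top (hμ.1 ▸ ENNReal.le_tsum 0)
  rw [genFun_poissonPMF hα hs0] at hG
  generalize genFun (shiftLaw μ) (ENNReal.ofReal s) = H at *
  generalize genFun μ (ENNReal.ofReal s) = G at *
  have hGt : G ≠ ∞ := ne_top_of_le_ne_top ENNReal.one_ne_top hG1
  have hHt : H ≠ ∞ := ne_top_of_le_ne_top ENNReal.one_ne_top hH1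
  have hHr : H.toReal ≤ 1 := by simpa using ENNReal.toReal_mono ENNReal.one_ne_top hH1
  have hle : 2⁻¹ * H ≤ 1 := mul_le_one' (by simp) hH1
  have hG' := congrArg ENNReal.toReal hG
  have hH' := congrArg ENNReal.toReal hH
  rw [ENNReal.toReal_mul, ENNReal.toReal_mul, ENNReal.toReal_inv (1 - 2⁻¹ * H),
    ENNReal.toReal_sub_of_le hle ENNReal.one_ne_top, ENNReal.toReal_mul,
    ENNReal.toReal_ofReal (Real.exp_pos _).le, ENNReal.toReal_inv, ENNReal.toReal_ofNat,
    ENNReal.toReal_one] at hG'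
  rw [ENNReal.toReal_add (ENNReal.mul_ne_top ENNReal.ofReal_ne_top hHt) hp,
    ENNReal.toReal_add (ENNReal.mul_ne_top ENNReal.ofReal_ne_top hp) hGt,
    ENNReal.toReal_mul, ENNReal.toReal_mul, ENNReal.toReal_ofReal hs0] at hH'
  have hne : 1 - (2 : ℝ)⁻¹ * H.toReal ≠ 0 := by linarith
  have hGe : G.toReal * (2 - H.toReal) = Real.exp (α * (s - 1)) := by
    rw [hG']
    field_simp
    have : 2 - H.toReal ≠ 0 := by linarith
    field_simp
  rw [← hGe]
  linear_combination G.toReal * hH'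

theorem one_le_genFun_add_meanENN {μ : ℕ → ℝ≥0∞} (hμ : ∑' k, μ k = 1) {t : ℝ} (ht0 : 0 ≤ t)
    (ht1 : t ≤ 1) :
    1 ≤ genFun μ (ENNReal.ofReal (1 - t)) + meanENN μ * ENNReal.ofReal t := by
  rw [← hμ, genFun, meanENN, ← ENNReal.tsum_mul_right, ← ENNReal.tsum_add]
  refine ENNReal.tsum_le_tsum fun k => ?_
  have hb : 1 ≤ (1 - t) ^ k + k * t := by
    have := one_add_mul_le_pow (show (-2 : ℝ) ≤ -t by linarith) k
    rw [← sub_eq_add_neg] at this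
    linarith
  have hb' : 1 ≤ ENNReal.ofReal (1 - t) ^ k + k * ENNReal.ofReal t := by
    rw [← ENNReal.ofReal_pow (by linarith), ← ENNReal.ofReal_natCast k,
      ← ENNReal.ofReal_mul (by positivity),
      ← ENNReal.ofReal_add (pow_nonneg (by linarith) k) (by positivity)]
    exact ENNReal.one_le_ofReal.mpr hb
  calc μ k = μ k * 1 := (mul_one _).symm
    _ ≤ μ k * (ENNReal.ofReal (1 - t) ^ k + k * ENNReal.ofReal t) := by gcongr
    _ = _ := by ring

theorem Real.cubic_le_exp_neg {x : ℝ} (hx0 : 0 ≤ x) (hx1 : x ≤ 1) :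
    1 - x + x ^ 2 / 2 - x ^ 3 ≤ Real.exp (-x) := by
  have h := Real.exp_bound (x := -x) (by rwa [abs_neg, abs_of_nonneg hx0]) (n := 3) (by norm_num)
  rw [abs_neg, abs_of_nonneg hx0] at h
  norm_num [Finset.sum_range_succ, Nat.factorial] at h
  have := (abs_le.mp h).1
  nlinarith [pow_nonneg hx0 3]

theorem SatisfiesRDE.one_sub_lt {α : ℝ} {μ : ℕ → ℝ≥0∞} (hμ : SatisfiesRDE α μ)
    (hα0 : √2 - 1 < α) (hα1 : α < 1) : 1 - α < (μ 0).toReal := by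
  have h2 : (1 : ℝ) < √2 := Real.lt_sqrt_of_sq_lt (by norm_num)
  have hα : 0 < α := by linarith
  have hc : 0 < α ^ 2 + 2 * α - 1 := by
    nlinarith [Real.sq_sqrt (show (0 : ℝ) ≤ 2 by norm_num)]
  by_contra! hp
  have hp0 : 0 ≤ (μ 0).toReal := ENNReal.toReal_nonneg
  obtain ⟨t, ht⟩ : ∃ t, t = (α ^ 2 + 2 * α - 1) / 12 := ⟨_, rfl⟩
  have ht0 : 0 < t := by rw [ht]; positivity
  have ht1 : t < 1 := by rw [ht]; nlinarith
  have hq := hμ.quadratic hα.le (s := 1 - t) (by linarith) (by linarith)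
  generalize (genFun μ (ENNReal.ofReal (1 - t))).toReal = G at hq
  generalize (μ 0).toReal = p at *
  have he := Real.cubic_le_exp_neg (x := α * t) (by positivity) (by nlinarith)
  rw [show α * (1 - t - 1) = -(α * t) by ring] at hq
  generalize Real.exp (-(α * t)) = E at *
  have hD : 4 * ((1 - t) * E) ≤ (p + (2 - p) * (1 - t)) ^ 2 := by
    rw [← hq]
    nlinarith [sq_nonneg (2 * G - (p + (2 - p) * (1 - t)))]
  have hA : (p + (2 - p) * (1 - t)) ^ 2 ≤ (2 - (1 + α) * t) ^ 2 := by
    apply pow_le_pow_left₀ <;> nlinarith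
  have hE := mul_le_mul_of_nonneg_left he (show 0 ≤ 1 - t by linarith)
  have hexpand : 4 * ((1 - t) * (1 - α * t + (α * t) ^ 2 / 2 - (α * t) ^ 3))
      = (2 - (1 + α) * t) ^ 2 + t ^ 2 * (α ^ 2 + 2 * α - 1)
        - t ^ 3 * (2 * α ^ 2 + 4 * α ^ 3 * (1 - t)) := by ring
  have hα2 : α ^ 2 ≤ 1 := pow_le_one₀ hα.le hα1.le
  have hα3 : α ^ 3 ≤ 1 := pow_le_one₀ hα.le hα1.le
  have hrem : 2 * α ^ 2 + 4 * α ^ 3 * (1 - t) ≤ 6 := by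
    nlinarith [mul_le_mul hα3 (show 1 - t ≤ 1 by linarith) (by linarith) zero_le_one]
  have h3 := mul_le_mul_of_nonneg_left hrem (pow_pos ht0 3).le
  have h4 : t ^ 2 * (α ^ 2 + 2 * α - 1) = 12 * t ^ 3 := by
    rw [show α ^ 2 + 2 * α - 1 = 12 * t by rw [ht]; ring]
    ring
  have := pow_pos ht0 3
  linarith

theorem SatisfiesRDE.meanENN_eq_top {α : ℝ} {μ : ℕ → ℝ≥0∞} (hμ : SatisfiesRDE α μ)
    (hα0 : 0 ≤ α) (hα1 : α ≤ 1) (hp : 1 - α < (μ 0).toReal) : meanENN μ = ⊤ := by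
  by_contra hm
  have hμ0 : μ 0 ≤ 1 := hμ.1 ▸ ENNReal.le_tsum 0
  have hp1 : (μ 0).toReal ≤ 1 := by simpa using ENNReal.toReal_mono ENNReal.one_ne_top hμ0
  obtain ⟨m, hm'⟩ : ∃ m, m = (meanENN μ).toReal := ⟨_, rfl⟩
  have hm0 : 0 ≤ m := hm' ▸ ENNReal.toReal_nonneg
  obtain ⟨t, ht⟩ : ∃ t, t = ((μ 0).toReal - (1 - α)) / (4 + (2 * m + 2) ^ 2) := ⟨_, rfl⟩
  have hK : 0 < 4 + (2 * m + 2) ^ 2 := by positivity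
  have ht0 : 0 < t := by rw [ht]; exact div_pos (by linarith) hK
  have htK : t * (4 + (2 * m + 2) ^ 2) = (μ 0).toReal - (1 - α) := by
    rw [ht]; field_simp
  have ht1 : t < 1 := by
    rw [ht, div_lt_one hK]
    nlinarith
  have hq := hμ.quadratic hα0 (s := 1 - t) (by linarith) (by linarith)
  have hG1 : genFun μ (ENNReal.ofReal (1 - t)) ≤ 1 :=
    hμ.1 ▸ genFun_le_tsum μ (ENNReal.ofReal_le_one.mpr (by linarith))
  have hB := one_le_genFun_add_meanENN hμ.1 ht0.le ht1.le
  generalize genFun μ (ENNReal.ofReal (1 - t)) = G at *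
  have hGt : G ≠ ∞ := ne_top_of_le_ne_top ENNReal.one_ne_top hG1
  have hGr : G.toReal ≤ 1 := by simpa using ENNReal.toReal_mono ENNReal.one_ne_top hG1
  have hmt := ENNReal.mul_ne_top hm (ENNReal.ofReal_ne_top (r := t))
  have hBr := ENNReal.toReal_mono (ENNReal.add_ne_top.mpr ⟨hGt, hmt⟩) hB
  rw [ENNReal.toReal_add hGt hmt, ENNReal.toReal_mul, ENNReal.toReal_ofReal ht0.le,
    ENNReal.toReal_one, ← hm'] at hBr
  have hp0 : 0 ≤ (μ 0).toReal := ENNReal.toReal_nonneg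
  generalize (μ 0).toReal = p at *
  generalize G.toReal = g at *
  have hat : α * t ≤ 1 := by nlinarith
  have he := (abs_le.mp (Real.abs_exp_sub_one_sub_id_le (x := -(α * t))
    (by rwa [abs_neg, abs_of_nonneg (by positivity)]))).2
  rw [show α * (1 - t - 1) = -(α * t) by ring] at hq
  generalize Real.exp (-(α * t)) = E at *
  have hsq : (2 * g - (p + (2 - p) * (1 - t))) ^ 2 ≤ ((2 * m + 2) * t) ^ 2 := by
    apply sq_le_sq'
    · nlinarith
    · nlinarith
  have hid : (2 * g - (p + (2 - p) * (1 - t))) ^ 2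
      = (p + (2 - p) * (1 - t)) ^ 2 - 4 * ((1 - t) * E) := by
    rw [← hq]; ring
  have hE : (1 - t) * E ≤ (1 - t) * (1 - α * t + t ^ 2) := by
    apply mul_le_mul_of_nonneg_left _ (by linarith)
    have : (α * t) ^ 2 ≤ t ^ 2 := by
      apply pow_le_pow_left₀ <;> nlinarith
    nlinarith
  have hexpand : (p + (2 - p) * (1 - t)) ^ 2 - 4 * ((1 - t) * (1 - α * t + t ^ 2))
      = 4 * t * (p - (1 - α)) + t ^ 2 * ((2 - p) ^ 2 - 4 * α - 4 * (1 - t)) := by ring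
  have hrem : -4 - 4 ≤ (2 - p) ^ 2 - 4 * α - 4 * (1 - t) := by nlinarith [sq_nonneg (2 - p)]
  have h3 := mul_le_mul_of_nonneg_left hrem (sq_nonneg t)
  have h4 : 4 * t * (p - (1 - α)) = 4 * t ^ 2 * (4 + (2 * m + 2) ^ 2) := by
    rw [← htK]; ring
  nlinarith [pow_pos ht0 2, mul_nonneg (sq_nonneg t) (sq_nonneg (2 * m + 2))]

/-- For √2 − 1 < α < 1, any X satisfying the RDE has P(X = 0) > 1 − α
and E[X] = ∞. -/
theorem prob_zero_gt_and_infinite_mean_large_alpha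
    (α : ℝ) (hα0 : Real.sqrt 2 - 1 < α) (hα1 : α < 1)
    (μ : ℕ → ℝ≥0∞) (hμ : SatisfiesRDE α μ) :
    1 - α < (μ 0).toReal ∧ meanENN μ = ⊤ := by
  have h2 : (1 : ℝ) < √2 := Real.lt_sqrt_of_sq_lt (by norm_num)
  have hp := hμ.one_sub_lt hα0 hα1
  exact ⟨hp, hμ.meanENN_eq_top (by linarith) hα1.le hp⟩
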